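/- For every integer k ≥ 2, every Young diagram λ, and every positive integer s, the free cumulants are homogeneous of degree k under dilation: R_k^{sλ} = s^k · R_k^λ. -/

import Mathlib

open scoped BigOperators

namespace AsympRep

/-- A fixed filling: the canonical bijection between `Fin μ.card` and the cells of `μ`. -/
noncomputable def fill (μ : YoungDiagram) : Fin μ.card ≃ {c // c ∈ μ.cells} :=
  (Fintype.equivFinOfCardEq (Fintype.card_coe _)).symm

/-- Row coordinate of the box occupied by `x` in the canonical filling. -/
noncomputable def rowOf (μ : YoungDiagram) (x : Fin μ.card) : ℕ := (fill μ x).1.1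

/-- Column coordinate of the box occupied by `x` in the canonical filling. -/
noncomputable def colOf (μ : YoungDiagram) (x : Fin μ.card) : ℕ := (fill μ x).1.2

/-- The Young symmetrizer `c_μ = a_μ * b_μ` in the group algebra `ℚ[S_n]`, `n = |μ|`,
where `a_μ` is the sum of the row-preserving permutations and `b_μ` is the signed sum
of the column-preserving permutations (for the canonical filling of `μ`). -/
noncomputable def youngSymmetrizer (μ : YoungDiagram) :
    MonoidAlgebra ℚ (Equiv.Perm (Fin μ.card)) :=
  (∑ g : Equiv.Perm (Fin μ.card),
      if ∀ x, rowOf μ (g x) = rowOf μ x then MonoidAlgebra.single g (1 : ℚ) else 0) *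
  (∑ g : Equiv.Perm (Fin μ.card),
      if ∀ x, colOf μ (g x) = colOf μ x
      then MonoidAlgebra.single g ((Equiv.Perm.sign g : ℤ) : ℚ) else 0)

/-- The Specht module: the left ideal `ℚ[S_n]·c_μ`, realizing the irreducible
representation `ρ^μ` of `S_n` (by left multiplication). -/
noncomputable def spechtModule (μ : YoungDiagram) :
    Submodule ℚ (MonoidAlgebra ℚ (Equiv.Perm (Fin μ.card))) :=
  LinearMap.range (LinearMap.mulRight ℚ (youngSymmetrizer μ))

theorem spechtModule_invariant (μ : YoungDiagram) (π : Equiv.Perm (Fin μ.card)) :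
    ∀ x ∈ spechtModule μ,
      (LinearMap.mulLeft ℚ (MonoidAlgebra.single π (1 : ℚ))) x ∈ spechtModule μ := by
  rintro x ⟨y, rfl⟩
  exact ⟨MonoidAlgebra.single π (1 : ℚ) * y, by
    simp only [LinearMap.mulRight_apply, LinearMap.mulLeft_apply, mul_assoc]⟩

/-- The irreducible character `χ^μ(π) = Tr ρ^μ(π)` of the symmetric group `S_n`,
`n = |μ|`, computed as the trace of left multiplication by `π` on the Specht module. -/
noncomputable def irrChar (μ : YoungDiagram) (π : Equiv.Perm (Fin μ.card)) : ℚ :=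
  LinearMap.trace ℚ (spechtModule μ)
    ((LinearMap.mulLeft ℚ (MonoidAlgebra.single π (1 : ℚ))).restrict
      (spechtModule_invariant μ π))

/-- The normalized character
`Σ_π^μ = n(n-1)⋯(n-k+1) · Tr ρ^μ(π) / Tr ρ^μ(e)` for `π ∈ S_k`, where `π` is regarded
as a permutation of `{1,…,n}` acting as the identity on `{k+1,…,n}`; it is `0` if `k > n`. -/
noncomputable def normChar {k : ℕ} (μ : YoungDiagram) (π : Equiv.Perm (Fin k)) : ℚ :=
  if h : k ≤ μ.card then
    (μ.card.descFactorial k : ℚ)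
      * irrChar μ (π.viaEmbedding (Fin.castLEEmb h)) / irrChar μ 1
  else 0

/-- `Σ_m^μ`: the normalized character on the `m`-cycle `(1,2,…,m) ∈ S_m`. -/
noncomputable def SigmaCycle (μ : YoungDiagram) (m : ℕ) : ℚ := normChar μ (finRotate m)

/-- The dilation `sμ` of a Young diagram: every box is replaced by an `s × s` grid
of boxes. -/
def dilate (μ : YoungDiagram) (s : ℕ) : YoungDiagram where
  cells := (Finset.range (s * μ.colLen 0) ×ˢ Finset.range (s * μ.rowLen 0)).filter
      (fun c => (c.1 / s, c.2 / s) ∈ μ.cells)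
  isLowerSet := by
    intro a b hba h
    simp only [Finset.coe_filter, Set.mem_setOf_eq, Finset.mem_product,
      Finset.mem_range] at h ⊢
    exact ⟨⟨lt_of_le_of_lt hba.1 h.1.1, lt_of_le_of_lt hba.2 h.1.2⟩,
      μ.isLowerSet (Prod.mk_le_mk.mpr
        ⟨Nat.div_le_div_right hba.1, Nat.div_le_div_right hba.2⟩) h.2⟩

open scoped Classical in
/-- The `k`-th free cumulant `R_k^μ`: the coefficient of `s^k` in the polynomial
`s ↦ Σ_{k-1}^{sμ}`. -/
noncomputable def freeCumulant (μ : YoungDiagram) (k : ℕ) : ℚ :=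
  if h : ∃ p : Polynomial ℚ, ∀ s : ℕ, 0 < s →
      SigmaCycle (dilate μ s) (k - 1) = Polynomial.eval (s : ℚ) p
  then h.choose.coeff k else 0

/-- `N^μ(σ₁,σ₂)`: the number of colorings of the cycles of `σ₁` (by column numbers)
and of the cycles of `σ₂` (by row numbers) compatible with `μ`.  A coloring of the
cycles is encoded as a pair of functions on points constant on the respective cycles;
compatibility means that for every point `a` the box in column `h₁(a)` and row `h₂(a)`
belongs to `μ` (two cycles intersect precisely when they share a point). -/
noncomputable def Ncolorings {k : ℕ} (μ : YoungDiagram) (σ₁ σ₂ : Equiv.Perm (Fin k)) : ℕ :=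
  Set.ncard {h : (Fin k → ℕ) × (Fin k → ℕ) |
    (∀ a, h.1 (σ₁ a) = h.1 a) ∧ (∀ a, h.2 (σ₂ a) = h.2 a) ∧
    ∀ a, (h.2 a, h.1 a) ∈ μ.cells }

/-- `|C(σ)|`: the number of cycles of a permutation (fixed points count as cycles),
i.e. the number of orbits. -/
noncomputable def numCycles {k : ℕ} (σ : Equiv.Perm (Fin k)) : ℕ :=
  Set.ncard {s : Set (Fin k) | ∃ a, s = {b | σ.SameCycle a b}}

/-- The region of the plane occupied by the Young diagram `μ` drawn in the French
convention (row `i` of the diagram, `0`-indexed, occupies `[0, μ_i] × [i, i+1]`). -/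
def frenchRegion (μ : YoungDiagram) : Set (ℝ × ℝ) :=
  {p | 0 ≤ p.1 ∧ 0 ≤ p.2 ∧ p.1 ≤ (μ.rowLen ⌊p.2⌋.toNat : ℝ)}

/-- The parameter `S_i^μ = (i-1) ∬_{(x,y)∈μ} (x-y)^{i-2} dx dy` (French convention). -/
noncomputable def Sparam (μ : YoungDiagram) (i : ℕ) : ℝ :=
  ((i : ℝ) - 1) * ∫ p in frenchRegion μ, (p.1 - p.2) ^ (i - 2)

/-- The profile `ω : ℝ → ℝ` of a Young diagram: the boundary of the diagram drawn in
the Russian convention, i.e. the image of the French region under the rotation by `π/4`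
composed with the dilation by `√2`, `(x, y) ↦ (x - y, x + y)`.  `ω(u)` is the largest
`v` with `(u,v)` in the rotated region, and `ω(u) = |u|` away from the diagram. -/
noncomputable def profile (μ : YoungDiagram) (u : ℝ) : ℝ :=
  max |u| (sSup {v : ℝ | ((u + v) / 2, (v - u) / 2) ∈ frenchRegion μ})

theorem sum_range_card_lt_sum {S : Finset ℕ} (hS : S ≠ Finset.range S.card) :
    ∑ i ∈ Finset.range S.card, i < ∑ i ∈ S, i := by
  set R := Finset.range S.card with hR
  have hcard : (S \ R).card = (R \ S).card := by
    have h1 := Finset.card_sdiff_add_card_inter S R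
    have h2 := Finset.card_sdiff_add_card_inter R S
    rw [Finset.inter_comm] at h2
    have h3 : R.card = S.card := Finset.card_range _
    omega
  have hne : (R \ S).Nonempty := by
    rw [Finset.nonempty_iff_ne_empty]
    intro h
    rw [h, Finset.card_empty, Finset.card_eq_zero] at hcard
    exact hS (le_antisymm (Finset.sdiff_eq_empty_iff_subset.mp hcard)
      (Finset.sdiff_eq_empty_iff_subset.mp h))
  have h1 : ∑ i ∈ R \ S, i < (R \ S).card * S.card := by
    rw [← smul_eq_mul, ← Finset.sum_const]
    exact Finset.sum_lt_sum_of_nonempty hne fun i hi =>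
      Finset.mem_range.mp (Finset.mem_sdiff.mp hi).1
  have h2 : (S \ R).card * S.card ≤ ∑ i ∈ S \ R, i := by
    rw [← smul_eq_mul]
    refine Finset.card_nsmul_le_sum _ _ _ fun i hi => ?_
    simpa [hR] using (Finset.mem_sdiff.mp hi).2
  rw [hcard] at h2
  have h3 := Finset.sum_inter_add_sum_sdiff S R (fun i => i)
  have h4 := Finset.sum_inter_add_sum_sdiff R S (fun i => i)
  rw [Finset.inter_comm] at h4
  omega

section

variable {μ : YoungDiagram}

theorem fill_injective_coords {x y : Fin μ.card} (hr : rowOf μ x = rowOf μ y)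
    (hc : colOf μ x = colOf μ y) : x = y :=
  (fill μ).injective (Subtype.ext (Prod.ext hr hc))

theorem coords_mem (x : Fin μ.card) : (rowOf μ x, colOf μ x) ∈ μ.cells := (fill μ x).2

theorem exists_coords {i j : ℕ} (h : (i, j) ∈ μ.cells) :
    ∃ x, rowOf μ x = i ∧ colOf μ x = j :=
  ⟨(fill μ).symm ⟨(i, j), h⟩, by simp [rowOf], by simp [colOf]⟩

theorem image_rowOf_col (j : ℕ) :
    (Finset.univ.filter fun x => colOf μ x = j).image (rowOf μ) = Finset.range (μ.colLen j) := by
  ext i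
  simp only [Finset.mem_image, Finset.mem_filter, Finset.mem_univ, true_and, Finset.mem_range,
    ← YoungDiagram.mem_iff_lt_colLen]
  constructor
  · rintro ⟨x, rfl, rfl⟩
    exact coords_mem x
  · intro h
    obtain ⟨x, hx, hy⟩ := exists_coords h
    exact ⟨x, hy, hx⟩

theorem injOn_rowOf_col (j : ℕ) :
    Set.InjOn (rowOf μ) (Finset.univ.filter fun x => colOf μ x = j : Finset (Fin μ.card)) := by
  intro x hx y hy h
  simp only [Finset.coe_filter, Finset.mem_univ, true_and, Set.mem_ofPred_eq] at hx hy
  exact fill_injective_coords h (hx.trans hy.symm)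

/-- If no two entries in a common row of the canonical filling lie in a common column of its
image under `g`, then `g` is the product of a row permutation and a column permutation. -/
theorem exists_row_mul_col (g : Equiv.Perm (Fin μ.card))
    (hg : ∀ x y, rowOf μ (g x) = rowOf μ (g y) → colOf μ x = colOf μ y → x = y) :
    ∃ r q : Equiv.Perm (Fin μ.card), (∀ x, rowOf μ (r x) = rowOf μ x) ∧
      (∀ x, colOf μ (q x) = colOf μ x) ∧ g = r * q := by
  have hinj (j : ℕ) : Set.InjOn (fun x => rowOf μ (g x))
      (Finset.univ.filter fun x => colOf μ x = j : Finset (Fin μ.card)) := by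
    intro x hx y hy h
    simp only [Finset.coe_filter, Finset.mem_univ, true_and, Set.mem_ofPred_eq] at hx hy
    exact hg x y h (hx.trans hy.symm)
  let S (j : ℕ) := (Finset.univ.filter fun x => colOf μ x = j).image fun x => rowOf μ (g x)
  have hScard (j : ℕ) : (S j).card = μ.colLen j := by
    rw [Finset.card_image_of_injOn (hinj j), ← Finset.card_image_of_injOn (injOn_rowOf_col j),
      image_rowOf_col, Finset.card_range]
  have hSsum (j : ℕ) : ∑ i ∈ S j, i = ∑ x with colOf μ x = j, rowOf μ (g x) :=
    Finset.sum_image (hinj j)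
  have hRsum (j : ℕ) : ∑ i ∈ Finset.range (μ.colLen j), i = ∑ x with colOf μ x = j, rowOf μ x := by
    rw [← image_rowOf_col, Finset.sum_image (injOn_rowOf_col j)]
  have hle (j : ℕ) : ∑ x with colOf μ x = j, rowOf μ x ≤ ∑ x with colOf μ x = j, rowOf μ (g x) := by
    rw [← hRsum, ← hSsum, ← hScard]
    by_cases h : S j = Finset.range (S j).card
    · exact (congrArg (fun T : Finset ℕ => ∑ i ∈ T, i) h).ge
    · exact (sum_range_card_lt_sum h).le
  have htot : ∑ j ∈ Finset.univ.image (colOf μ), ∑ x with colOf μ x = j, rowOf μ x =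
      ∑ j ∈ Finset.univ.image (colOf μ), ∑ x with colOf μ x = j, rowOf μ (g x) := by
    rw [Finset.sum_fiberwise_of_maps_to (by simp), Finset.sum_fiberwise_of_maps_to (by simp)]
    exact (Equiv.sum_comp g (rowOf μ)).symm
  have heq := (Finset.sum_eq_sum_iff_of_le fun j _ => hle j).mp htot
  have hS (j : ℕ) (hj : j ∈ Finset.univ.image (colOf μ)) : S j = Finset.range (μ.colLen j) := by
    by_contra h
    rw [← hScard] at h
    have := sum_range_card_lt_sum h
    rw [hScard, hRsum, hSsum, heq j hj] at this
    exact lt_irrefl _ this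
  have hmem (x : Fin μ.card) : (rowOf μ (g x), colOf μ x) ∈ μ.cells := by
    have : rowOf μ (g x) ∈ S (colOf μ x) := Finset.mem_image.mpr ⟨x, by simp, rfl⟩
    rw [hS _ (by simp), Finset.mem_range, ← YoungDiagram.mem_iff_lt_colLen] at this
    exact this
  choose f hf using fun x => exists_coords (hmem x)
  have hfinj : Function.Injective f := fun x y h =>
    hg x y (by rw [← (hf x).1, ← (hf y).1, h]) (by rw [← (hf x).2, ← (hf y).2, h])
  let q : Equiv.Perm (Fin μ.card) := Equiv.ofBijective f (Finite.injective_iff_bijective.mp hfinj)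
  refine ⟨g * q⁻¹, q, fun x => ?_, fun x => (hf x).2, by simp⟩
  obtain ⟨y, rfl⟩ := q.surjective x
  have hy : rowOf μ (q y) = rowOf μ (g y) := (hf y).1
  simpa using hy.symm

/-- A function on `S_n` that is invariant under row permutations on the left and
anti-invariant under column permutations on the right is determined by its value at `1`. -/
theorem eq_zero_of_row_col_equivariant (h : Equiv.Perm (Fin μ.card) → ℚ)
    (hrow : ∀ r g : Equiv.Perm (Fin μ.card), (∀ x, rowOf μ (r x) = rowOf μ x) → h (r * g) = h g)
    (hcol : ∀ q g : Equiv.Perm (Fin μ.card), (∀ x, colOf μ (q x) = colOf μ x) →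
      h (g * q) = ((Equiv.Perm.sign q : ℤ) : ℚ) * h g)
    (h1 : h 1 = 0) (g : Equiv.Perm (Fin μ.card)) : h g = 0 := by
  by_cases hg : ∀ x y, rowOf μ (g x) = rowOf μ (g y) → colOf μ x = colOf μ y → x = y
  · obtain ⟨r, q, hr, hq, rfl⟩ := exists_row_mul_col g hg
    rw [hrow r q hr, ← one_mul q, hcol q 1 hq, h1, mul_zero]
  · push Not at hg
    obtain ⟨x, y, hr, hc, hxy⟩ := hg
    have e1 : h (Equiv.swap (g x) (g y) * g) = h g := by
      refine hrow _ _ fun z => ?_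
      by_cases hz1 : z = g x
      · subst hz1; simp [hr]
      by_cases hz2 : z = g y
      · subst hz2; simp [hr]
      rw [Equiv.swap_apply_of_ne_of_ne hz1 hz2]
    have e2 : h (g * Equiv.swap x y) = -h g := by
      rw [hcol _ _ fun z => ?_, Equiv.Perm.sign_swap hxy]
      · simp
      by_cases hz1 : z = x
      · subst hz1; simp [hc]
      by_cases hz2 : z = y
      · subst hz2; simp [hc]
      rw [Equiv.swap_apply_of_ne_of_ne hz1 hz2]
    rw [← Equiv.mul_swap_eq_swap_mul, e2] at e1
    linarith

theorem sign_mul_self_cast {α : Type*} [DecidableEq α] [Fintype α] (q : Equiv.Perm α) :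
    ((Equiv.Perm.sign q : ℤ) : ℚ) * ((Equiv.Perm.sign q : ℤ) : ℚ) = 1 := by
  rw [← Int.cast_mul, ← Units.val_mul, Int.units_mul_self, Units.val_one, Int.cast_one]

theorem coeff_youngSymmetrizer (μ : YoungDiagram) (g : Equiv.Perm (Fin μ.card)) :
    (youngSymmetrizer μ).coeff g = ∑ q : Equiv.Perm (Fin μ.card),
      if (∀ x, rowOf μ (g (q⁻¹ x)) = rowOf μ x) ∧ ∀ x, colOf μ (q x) = colOf μ x
      then ((Equiv.Perm.sign q : ℤ) : ℚ) else 0 := by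
  have key (h : Equiv.Perm (Fin μ.card)) : (∑ g : Equiv.Perm (Fin μ.card),
      if ∀ x, rowOf μ (g x) = rowOf μ x then MonoidAlgebra.single g (1 : ℚ) else 0).coeff h =
      if ∀ x, rowOf μ (h x) = rowOf μ x then 1 else 0 := by
    rw [MonoidAlgebra.coeff_sum, Finset.sum_apply', Finset.sum_eq_single h]
    · split_ifs <;> simp
    · intro b _ hb
      split_ifs <;> simp [hb]
    · simp
  rw [youngSymmetrizer, Finset.mul_sum, MonoidAlgebra.coeff_sum, Finset.sum_apply']
  refine Finset.sum_congr rfl fun q _ => ?_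
  by_cases hq : ∀ x, colOf μ (q x) = colOf μ x
  · rw [if_pos hq, MonoidAlgebra.coeff_mul_single_apply, key]
    by_cases hg : ∀ x, rowOf μ ((g * q⁻¹) x) = rowOf μ x
    · rw [if_pos hg, if_pos ⟨hg, hq⟩, one_mul]
    · rw [if_neg hg, if_neg fun h => hg h.1, zero_mul]
  · rw [if_neg hq]
    simp [hq]

theorem coeff_youngSymmetrizer_one (μ : YoungDiagram) : (youngSymmetrizer μ).coeff 1 = 1 := by
  rw [coeff_youngSymmetrizer, Finset.sum_eq_single 1]
  · simp
  · intro q _ hq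
    refine if_neg fun h => hq (Equiv.ext fun x => ?_)
    refine fill_injective_coords ?_ (h.2 x)
    simpa using (h.1 (q x)).symm
  · simp

theorem single_mul_youngSymmetrizer (r : Equiv.Perm (Fin μ.card))
    (hr : ∀ x, rowOf μ (r x) = rowOf μ x) :
    MonoidAlgebra.single r (1 : ℚ) * youngSymmetrizer μ = youngSymmetrizer μ := by
  rw [← MonoidAlgebra.coeff_inj]
  ext g
  have hr' (x) : rowOf μ (r⁻¹ x) = rowOf μ x := by simpa using (hr (r⁻¹ x)).symm
  rw [MonoidAlgebra.coeff_single_mul_apply, one_mul, coeff_youngSymmetrizer,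
    coeff_youngSymmetrizer]
  simp only [Equiv.Perm.mul_apply, hr']

theorem youngSymmetrizer_mul_single (q : Equiv.Perm (Fin μ.card))
    (hq : ∀ x, colOf μ (q x) = colOf μ x) :
    youngSymmetrizer μ * MonoidAlgebra.single q (1 : ℚ) =
      ((Equiv.Perm.sign q : ℤ) : ℚ) • youngSymmetrizer μ := by
  rw [← MonoidAlgebra.coeff_inj]
  ext g
  rw [MonoidAlgebra.coeff_mul_single_apply, mul_one, MonoidAlgebra.coeff_smul, Finsupp.smul_apply,
    coeff_youngSymmetrizer, coeff_youngSymmetrizer, smul_eq_mul, Finset.mul_sum]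
  refine Eq.trans (Finset.sum_congr rfl fun p _ => ?_) (Equiv.sum_comp (Equiv.mulRight q) _)
  have hcol : (∀ x, colOf μ (p (q x)) = colOf μ x) ↔ ∀ x, colOf μ (p x) = colOf μ x := by
    rw [← q.forall_congr_right (q := fun x => colOf μ (p x) = colOf μ x)]
    simp only [hq]
  simp only [Equiv.coe_mulRight, mul_inv_rev, Equiv.Perm.mul_apply, hcol, mul_ite, mul_zero,
    Equiv.Perm.sign_mul, Units.val_mul, Int.cast_mul]
  congr 1
  linear_combination -((Equiv.Perm.sign p : ℤ) : ℚ) * sign_mul_self_cast q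

/-- The Young symmetrizer is quasi-idempotent. -/
theorem youngSymmetrizer_mul_self (μ : YoungDiagram) :
    ∃ κ : ℚ, youngSymmetrizer μ * youngSymmetrizer μ = κ • youngSymmetrizer μ := by
  set c := youngSymmetrizer μ with hc
  set κ := (c * c).coeff 1
  refine ⟨κ, ?_⟩
  rw [← sub_eq_zero, ← MonoidAlgebra.coeff_eq_zero]
  set d := c * c - κ • c
  have hrow (r : Equiv.Perm (Fin μ.card)) (hr : ∀ x, rowOf μ (r x) = rowOf μ x) :
      MonoidAlgebra.single r (1 : ℚ) * d = d := by
    simp only [d, mul_sub, ← mul_assoc, mul_smul_comm, hc, single_mul_youngSymmetrizer r hr]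
  have hcol (q : Equiv.Perm (Fin μ.card)) (hq : ∀ x, colOf μ (q x) = colOf μ x) :
      d * MonoidAlgebra.single q (1 : ℚ) = ((Equiv.Perm.sign q : ℤ) : ℚ) • d := by
    simp only [d, sub_mul, mul_assoc, smul_mul_assoc, hc, youngSymmetrizer_mul_single q hq,
      mul_smul_comm, smul_sub, smul_comm κ]
  ext g
  refine eq_zero_of_row_col_equivariant (fun g => d.coeff g) (fun r g hr => ?_) (fun q g hq => ?_)
    ?_ g
  · have := MonoidAlgebra.coeff_single_mul_apply d (1 : ℚ) r (r * g)
    rw [hrow r hr] at this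
    simpa using this
  · have := MonoidAlgebra.coeff_mul_single_apply d (1 : ℚ) q (g * q)
    rw [hcol q hq, MonoidAlgebra.coeff_smul, Finsupp.smul_apply, smul_eq_mul] at this
    simp only [mul_inv_cancel_right, mul_one] at this
    linear_combination ((Equiv.Perm.sign q : ℤ) : ℚ) * this - d.coeff (g * q) * sign_mul_self_cast q
  · simp [d, κ, hc, coeff_youngSymmetrizer_one]

/-- The trace of left multiplication by `π` composed with right multiplication by `x` on the
group algebra. -/
theorem trace_mulLeft_comp_mulRight {G : Type*} [Group G] [Fintype G] (π : G)
    (x : MonoidAlgebra ℚ G) :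
    LinearMap.trace ℚ (MonoidAlgebra ℚ G)
      (LinearMap.mulLeft ℚ (MonoidAlgebra.single π (1 : ℚ)) ∘ₗ LinearMap.mulRight ℚ x) =
      ∑ g : G, x.coeff (g * π⁻¹ * g⁻¹) := by
  classical
  rw [LinearMap.trace_eq_matrix_trace ℚ (MonoidAlgebra.basis G ℚ), Matrix.trace,
    ← Equiv.sum_comp (Equiv.inv G)]
  refine Finset.sum_congr rfl fun g _ => ?_
  rw [Matrix.diag_apply, LinearMap.toMatrix_apply, MonoidAlgebra.basis_apply]
  change (MonoidAlgebra.single π (1 : ℚ) * (MonoidAlgebra.single g⁻¹ (1 : ℚ) * x)).coeff g⁻¹ = _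
  rw [MonoidAlgebra.coeff_single_mul_apply, MonoidAlgebra.coeff_single_mul_apply]
  simp [mul_assoc]

theorem mul_irrChar {κ : ℚ}
    (hκ : youngSymmetrizer μ * youngSymmetrizer μ = κ • youngSymmetrizer μ)
    (π : Equiv.Perm (Fin μ.card)) :
    κ * irrChar μ π = ∑ g, (youngSymmetrizer μ).coeff (g * π⁻¹ * g⁻¹) := by
  set R := LinearMap.mulRight ℚ (youngSymmetrizer μ)
  set L := LinearMap.mulLeft ℚ (MonoidAlgebra.single π (1 : ℚ))
  have h := LinearMap.trace_comp_comm' (R := ℚ) R.rangeRestrict (L ∘ₗ (LinearMap.range R).subtype)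
  rw [LinearMap.comp_assoc, LinearMap.subtype_comp_codRestrict] at h
  rw [← trace_mulLeft_comp_mulRight, h, irrChar, ← smul_eq_mul, ← map_smul]
  congr 1
  ext ⟨_, x, rfl⟩ : 2
  change κ • (MonoidAlgebra.single π (1 : ℚ) * (x * youngSymmetrizer μ)) =
    MonoidAlgebra.single π (1 : ℚ) * (x * youngSymmetrizer μ) * youngSymmetrizer μ
  rw [mul_assoc, mul_assoc, hκ, mul_smul_comm, mul_smul_comm]

theorem irrChar_div_irrChar_one (π : Equiv.Perm (Fin μ.card)) :
    irrChar μ π / irrChar μ 1 =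
      (∑ g, (youngSymmetrizer μ).coeff (g * π⁻¹ * g⁻¹)) / (μ.card.factorial : ℚ) := by
  obtain ⟨κ, hκ⟩ := youngSymmetrizer_mul_self μ
  have h1 : κ * irrChar μ 1 = (μ.card.factorial : ℚ) := by
    rw [mul_irrChar hκ]
    simp [coeff_youngSymmetrizer_one, Fintype.card_perm]
  have hne : κ * irrChar μ 1 ≠ 0 := h1 ▸ by exact_mod_cast μ.card.factorial_ne_zero
  rw [← mul_irrChar hκ, ← h1, mul_div_mul_left _ _ (left_ne_zero_of_mul hne)]

/-- The signed number of factorizations `π = r * q` in `S_k` such that, when the points of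
`Fin k` are placed in boxes of `μ` by `f`, the permutation `r` preserves rows and `q` preserves
columns. -/
noncomputable def signedFactorizations (μ : YoungDiagram) {k : ℕ} (π : Equiv.Perm (Fin k))
    (f : Fin k → Fin μ.card) : ℚ :=
  ∑ q : Equiv.Perm (Fin k),
    if (∀ a, rowOf μ (f (π (q⁻¹ a))) = rowOf μ (f a)) ∧ ∀ a, colOf μ (f (q a)) = colOf μ (f a)
    then ((Equiv.Perm.sign q : ℤ) : ℚ) else 0

theorem coeff_youngSymmetrizer_conj (g π : Equiv.Perm (Fin μ.card)) :
    (youngSymmetrizer μ).coeff (g * π * g⁻¹) = signedFactorizations μ π g := by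
  rw [coeff_youngSymmetrizer, signedFactorizations, ← Equiv.sum_comp (MulAut.conj g).toEquiv]
  refine Finset.sum_congr rfl fun q _ => ?_
  have h1 : (∀ x, rowOf μ (g (π (q⁻¹ (g⁻¹ x)))) = rowOf μ x) ↔
      ∀ a, rowOf μ (g (π (q⁻¹ a))) = rowOf μ (g a) := by
    rw [← g.forall_congr_right]
    simp
  have h2 : (∀ x, colOf μ (g (q (g⁻¹ x))) = colOf μ x) ↔
      ∀ a, colOf μ (g (q a)) = colOf μ (g a) := by
    rw [← g.forall_congr_right]
    simp
  have h3 (x) : (g * π * g⁻¹) ((g * q * g⁻¹)⁻¹ x) = g (π (q⁻¹ (g⁻¹ x))) := by simp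
  simp only [MulEquiv.toEquiv_eq_coe, MulEquiv.coe_toEquiv, MulAut.conj_apply, h3]
  simp only [Equiv.Perm.mul_apply, h1, h2, Equiv.Perm.sign_mul, Equiv.Perm.sign_inv]
  congr 3
  rw [mul_right_comm, Int.units_mul_self, one_mul]

theorem sign_viaEmbedding {k n : ℕ} (q : Equiv.Perm (Fin k)) (ι : Fin k ↪ Fin n) :
    Equiv.Perm.sign (q.viaEmbedding ι) = Equiv.Perm.sign q := by
  classical
  rw [Equiv.Perm.viaEmbedding]
  convert Equiv.Perm.sign_extendDomain q _

theorem exists_eq_viaEmbedding {k n : ℕ} (ι : Fin k ↪ Fin n) (p : Equiv.Perm (Fin n))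
    (hp : ∀ x ∉ Set.range ι, p x = x) : ∃ q : Equiv.Perm (Fin k), q.viaEmbedding ι = p := by
  have h (a : Fin k) : ∃ b, ι b = p (ι a) := by
    by_contra hb
    exact hb ⟨a, (p.injective (hp _ hb)).symm⟩
  choose q hq using h
  have hinj : Function.Injective q := fun a b hab =>
    ι.injective (p.injective (by rw [← hq, ← hq, hab]))
  refine ⟨Equiv.ofBijective q (Finite.injective_iff_bijective.mp hinj), Equiv.ext fun x => ?_⟩
  by_cases hx : x ∈ Set.range ι
  · obtain ⟨a, rfl⟩ := hx
    rw [Equiv.Perm.viaEmbedding_apply, Equiv.ofBijective_apply, hq]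
  · rw [Equiv.Perm.viaEmbedding_apply_of_notMem _ _ _ hx, hp x hx]

theorem signedFactorizations_viaEmbedding {k : ℕ} (π : Equiv.Perm (Fin k))
    (ι : Fin k ↪ Fin μ.card) (g : Equiv.Perm (Fin μ.card)) :
    signedFactorizations μ (π.viaEmbedding ι) g = signedFactorizations μ π (g ∘ ι) := by
  symm
  have hinv (q : Equiv.Perm (Fin k)) : (q.viaEmbedding ι)⁻¹ = q⁻¹.viaEmbedding ι :=
    (map_inv (Equiv.Perm.viaEmbeddingHom ι) q).symm
  refine Finset.sum_of_injOn (fun q => q.viaEmbedding ι)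
    (Equiv.Perm.viaEmbeddingHom_injective ι).injOn (by simp) (fun p _ hp => ?_) fun q _ => ?_
  · refine if_neg fun h => hp ?_
    obtain ⟨q, hq⟩ := exists_eq_viaEmbedding ι p fun x hx => by
      refine g.injective (fill_injective_coords ?_ (h.2 x))
      have := h.1 (p x)
      rw [p.inv_def, p.symm_apply_apply, Equiv.Perm.viaEmbedding_apply_of_notMem _ _ _ hx] at this
      exact this.symm
    exact ⟨q, by simp, hq⟩
  · simp only [Function.comp_apply, sign_viaEmbedding, hinv]
    congr 1
    refine propext (and_congr ⟨fun h x => ?_, fun h a => ?_⟩ ⟨fun h x => ?_, fun h a => ?_⟩)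
    · by_cases hx : x ∈ Set.range ι
      · obtain ⟨a, rfl⟩ := hx
        simpa only [Equiv.Perm.viaEmbedding_apply] using h a
      · simp only [Equiv.Perm.viaEmbedding_apply_of_notMem _ _ _ hx]
    · simpa only [Equiv.Perm.viaEmbedding_apply] using h (ι a)
    · by_cases hx : x ∈ Set.range ι
      · obtain ⟨a, rfl⟩ := hx
        simpa only [Equiv.Perm.viaEmbedding_apply] using h a
      · simp only [Equiv.Perm.viaEmbedding_apply_of_notMem _ _ _ hx]
    · simpa only [Equiv.Perm.viaEmbedding_apply] using h (ι a)

theorem signedFactorizations_eq_zero {k : ℕ} (π : Equiv.Perm (Fin k)) (f : Fin k → Fin μ.card)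
    (hf : ¬ Function.Injective f) : signedFactorizations μ π f = 0 := by
  simp only [Function.Injective, not_forall] at hf
  obtain ⟨a, b, hab, hne⟩ := hf
  have hswap (c) : f (Equiv.swap a b c) = f c := by
    by_cases h1 : c = a
    · subst h1; simp [hab]
    by_cases h2 : c = b
    · subst h2; simp [hab]
    rw [Equiv.swap_apply_of_ne_of_ne h1 h2]
  suffices signedFactorizations μ π f = -signedFactorizations μ π f by linarith
  conv_lhs => rw [signedFactorizations, ← Equiv.sum_comp (Equiv.mulLeft (Equiv.swap a b))]
  rw [signedFactorizations, ← Finset.sum_neg_distrib]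
  refine Finset.sum_congr rfl fun q _ => ?_
  have h1 : (∀ c, rowOf μ (f (π (q⁻¹ (Equiv.swap a b c)))) = rowOf μ (f c)) ↔
      ∀ c, rowOf μ (f (π (q⁻¹ c))) = rowOf μ (f c) := by
    rw [← (Equiv.swap a b).forall_congr_right]
    simp [hswap]
  simp only [Equiv.coe_mulLeft, mul_inv_rev, Equiv.swap_inv, Equiv.Perm.mul_apply, hswap, h1,
    Equiv.Perm.sign_mul, Equiv.Perm.sign_swap hne]
  split_ifs <;> simp

/-- Averaging over `S_n` a function of the restriction to an embedded `Fin k`. -/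
theorem descFactorial_mul_sum_perm {k n : ℕ} (ι : Fin k ↪ Fin n) (F : (Fin k ↪ Fin n) → ℚ) :
    (n.descFactorial k : ℚ) * ∑ g : Equiv.Perm (Fin n), F (ι.trans g.toEmbedding) =
      (n.factorial : ℚ) * ∑ f : Fin k ↪ Fin n, F f := by
  classical
  let N (f : Fin k ↪ Fin n) : ℕ :=
    (Finset.univ.filter fun g : Equiv.Perm (Fin n) => ι.trans g.toEmbedding = f).card
  have hN (f : Fin k ↪ Fin n) : N f = N ι := by
    obtain ⟨h, rfl⟩ := (Equiv.Perm.isMultiplyPretransitive (Fin n) k).exists_smul_eq ι f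
    refine (Finset.card_equiv (Equiv.mulLeft h) fun g => ?_).symm
    simp only [Finset.mem_filter, Finset.mem_univ, true_and, Equiv.coe_mulLeft,
      DFunLike.ext_iff]
    simp
  have hsum (G : (Fin k ↪ Fin n) → ℚ) :
      ∑ g : Equiv.Perm (Fin n), G (ι.trans g.toEmbedding) = N ι * ∑ f, G f := by
    rw [← Finset.sum_fiberwise Finset.univ (fun g : Equiv.Perm (Fin n) => ι.trans g.toEmbedding),
      Finset.mul_sum]
    refine Finset.sum_congr rfl fun f _ => ?_
    rw [← hN f, Finset.sum_congr rfl fun g hg => congrArg G (Finset.mem_filter.mp hg).2,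
      Finset.sum_const, nsmul_eq_mul]
  have hcard := hsum fun _ => 1
  simp only [Finset.sum_const, Finset.card_univ, Fintype.card_perm, Fintype.card_fin,
    nsmul_eq_mul, mul_one, Fintype.card_embedding_eq] at hcard
  rw [hsum, hcard]
  ring

theorem normChar_eq_sum {k : ℕ} (μ : YoungDiagram) (π : Equiv.Perm (Fin k)) :
    normChar μ π = ∑ f : Fin k → Fin μ.card, signedFactorizations μ π⁻¹ f := by
  have hemb : ∑ f : Fin k ↪ Fin μ.card, signedFactorizations μ π⁻¹ f =
      ∑ f : Fin k → Fin μ.card, signedFactorizations μ π⁻¹ f := by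
    refine Finset.sum_of_injOn (fun f => f) DFunLike.coe_injective.injOn (by simp)
      (fun f _ hf => signedFactorizations_eq_zero _ _ fun h => hf ⟨⟨f, h⟩, by simp, rfl⟩)
      fun _ _ => rfl
  rw [normChar, ← hemb]
  split_ifs with h
  · rw [mul_div_assoc, irrChar_div_irrChar_one, mul_div_assoc']
    have hfact : (μ.card.factorial : ℚ) ≠ 0 := by exact_mod_cast μ.card.factorial_ne_zero
    rw [div_eq_iff hfact, mul_comm _ (μ.card.factorial : ℚ),
      ← descFactorial_mul_sum_perm (Fin.castLEEmb h) fun f => signedFactorizations μ π⁻¹ f]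
    congr 1
    refine Finset.sum_congr rfl fun g _ => ?_
    have hinv : (π.viaEmbedding (Fin.castLEEmb h))⁻¹ = π⁻¹.viaEmbedding (Fin.castLEEmb h) :=
      (map_inv (Equiv.Perm.viaEmbeddingHom _) π).symm
    rw [hinv, coeff_youngSymmetrizer_conj, signedFactorizations_viaEmbedding]
    rfl
  · have : IsEmpty (Fin k ↪ Fin μ.card) :=
      ⟨fun f => h (by simpa using Fintype.card_le_of_embedding f)⟩
    simp

theorem mem_dilate {s : ℕ} (hs : 0 < s) (μ : YoungDiagram) (c : ℕ × ℕ) :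
    c ∈ (dilate μ s).cells ↔ (c.1 / s, c.2 / s) ∈ μ.cells := by
  refine ⟨fun h => (Finset.mem_filter.mp h).2, fun h => Finset.mem_filter.mpr ⟨?_, h⟩⟩
  have h1 := YoungDiagram.mem_iff_lt_colLen.mp (μ.up_left_mem le_rfl (Nat.zero_le _) h)
  have h2 := YoungDiagram.mem_iff_lt_rowLen.mp (μ.up_left_mem (Nat.zero_le _) le_rfl h)
  rw [Nat.div_lt_iff_lt_mul hs, mul_comm] at h1 h2
  simpa using ⟨h1, h2⟩

theorem dilate_dilate (μ : YoungDiagram) {s t : ℕ} (hs : 0 < s) (ht : 0 < t) :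
    dilate (dilate μ s) t = dilate μ (s * t) := by
  refine YoungDiagram.ext (Finset.ext fun c => ?_)
  rw [mem_dilate ht, mem_dilate hs, mem_dilate (Nat.mul_pos hs ht)]
  simp only [Nat.div_div_eq_div_mul, mul_comm t s]

/-- The boxes of `dilate μ s` are pairs of a box of `μ` and a position in an `s × s` grid. -/
theorem exists_dilate_equiv (μ : YoungDiagram) {s : ℕ} (hs : 0 < s) :
    ∃ e : Fin (dilate μ s).card ≃ Fin μ.card × Fin s × Fin s, ∀ x y,
      (rowOf (dilate μ s) x = rowOf (dilate μ s) y ↔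
        rowOf μ (e x).1 = rowOf μ (e y).1 ∧ (e x).2.1 = (e y).2.1) ∧
      (colOf (dilate μ s) x = colOf (dilate μ s) y ↔
        colOf μ (e x).1 = colOf μ (e y).1 ∧ (e x).2.2 = (e y).2.2) := by
  have hmem (x : Fin (dilate μ s).card) :
      (rowOf (dilate μ s) x / s, colOf (dilate μ s) x / s) ∈ μ.cells :=
    (mem_dilate hs μ _).mp (coords_mem x)
  choose f hf using fun x => exists_coords (hmem x)
  let F (x : Fin (dilate μ s).card) : Fin μ.card × Fin s × Fin s :=
    (f x, ⟨rowOf (dilate μ s) x % s, Nat.mod_lt _ hs⟩, ⟨colOf (dilate μ s) x % s, Nat.mod_lt _ hs⟩)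
  have hdm (a b : ℕ) : a = b ↔ a / s = b / s ∧ a % s = b % s :=
    ⟨by rintro rfl; simp, fun ⟨h1, h2⟩ => by rw [← Nat.div_add_mod a s, h1, h2, Nat.div_add_mod]⟩
  have hF (x y) : (rowOf (dilate μ s) x = rowOf (dilate μ s) y ↔
        rowOf μ (F x).1 = rowOf μ (F y).1 ∧ (F x).2.1 = (F y).2.1) ∧
      (colOf (dilate μ s) x = colOf (dilate μ s) y ↔
        colOf μ (F x).1 = colOf μ (F y).1 ∧ (F x).2.2 = (F y).2.2) := by
    simp only [F, (hf x).1, (hf x).2, (hf y).1, (hf y).2, Fin.mk.injEq]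
    exact ⟨hdm _ _, hdm _ _⟩
  refine ⟨Equiv.ofBijective F ⟨fun x y h => ?_, fun ⟨z, i, j⟩ => ?_⟩, hF⟩
  · exact fill_injective_coords ((hF x y).1.mpr (by simp [h])) ((hF x y).2.mpr (by simp [h]))
  · have hdiv (a : ℕ) (i : Fin s) : (s * a + i) / s = a := by
      rw [Nat.mul_add_div hs, Nat.div_eq_of_lt i.2, add_zero]
    have hmod (a : ℕ) (i : Fin s) : (s * a + i) % s = i := by
      rw [Nat.mul_add_mod, Nat.mod_eq_of_lt i.2]
    have hz : (s * rowOf μ z + i, s * colOf μ z + j) ∈ (dilate μ s).cells := by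
      rw [mem_dilate hs, hdiv, hdiv]
      exact coords_mem z
    obtain ⟨x, hx, hy⟩ := exists_coords hz
    have hfx : f x = z := fill_injective_coords (by rw [(hf x).1, hx, hdiv])
      (by rw [(hf x).2, hy, hdiv])
    exact ⟨x, by simp [F, hfx, hx, hy, hmod]⟩

/-- The number of placements of the points of `Fin k` in the boxes of `μ` such that `r`
preserves rows and `q` preserves columns. -/
noncomputable def numPlacements {k : ℕ} (μ : YoungDiagram) (r q : Equiv.Perm (Fin k)) : ℕ :=
  Nat.card {f : Fin k → Fin μ.card //
    (∀ a, rowOf μ (f (r a)) = rowOf μ (f a)) ∧ ∀ a, colOf μ (f (q a)) = colOf μ (f a)}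

theorem normChar_eq_sum_numPlacements {k : ℕ} (μ : YoungDiagram) (π : Equiv.Perm (Fin k)) :
    normChar μ π = ∑ q : Equiv.Perm (Fin k),
      ((Equiv.Perm.sign q : ℤ) : ℚ) * numPlacements μ (π⁻¹ * q⁻¹) q := by
  rw [normChar_eq_sum]
  simp only [signedFactorizations]
  rw [Finset.sum_comm]
  refine Finset.sum_congr rfl fun q _ => ?_
  rw [← Finset.sum_filter, Finset.sum_const, nsmul_eq_mul, mul_comm, numPlacements,
    Nat.card_eq_fintype_card, Fintype.card_subtype]
  rfl

/-- Functions invariant under a permutation are counted by a power of the size of the target. -/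
theorem card_invariant_functions {k : ℕ} (r : Equiv.Perm (Fin k)) (s : ℕ) :
    Nat.card {ρ : Fin k → Fin s // ∀ a, ρ (r a) = ρ a} =
      s ^ Nat.card (Quotient (Equiv.Perm.SameCycle.setoid r)) := by
  have hinv (ρ : Fin k → Fin s) (hρ : ∀ a, ρ (r a) = ρ a) (a b) (h : r.SameCycle a b) :
      ρ a = ρ b := by
    obtain ⟨n, rfl⟩ := h.exists_nat_pow_eq
    induction n with
    | zero => rfl
    | succ n ih => rw [pow_succ', Equiv.Perm.mul_apply, hρ, ← ih ⟨n, rfl⟩]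
  let e : {ρ : Fin k → Fin s // ∀ a, ρ (r a) = ρ a} ≃
      (Quotient (Equiv.Perm.SameCycle.setoid r) → Fin s) :=
    { toFun := fun ρ => Quotient.lift ρ.1 (hinv ρ.1 ρ.2)
      invFun := fun φ => ⟨fun a => φ ⟦a⟧, fun a =>
        congrArg φ (Quotient.sound (Equiv.Perm.sameCycle_apply_left.mpr (.refl r a)))⟩
      left_inv := fun _ => rfl
      right_inv := fun φ => funext fun x => Quotient.inductionOn x fun _ => rfl }
  rw [Nat.card_congr e, Nat.card_fun, Nat.card_fin]

theorem numPlacements_dilate {k : ℕ} (μ : YoungDiagram) {s : ℕ} (hs : 0 < s)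
    (r q : Equiv.Perm (Fin k)) :
    numPlacements (dilate μ s) r q = numPlacements μ r q *
      (s ^ Nat.card (Quotient (Equiv.Perm.SameCycle.setoid r)) *
        s ^ Nat.card (Quotient (Equiv.Perm.SameCycle.setoid q))) := by
  obtain ⟨e, he⟩ := exists_dilate_equiv μ hs
  rw [← card_invariant_functions, ← card_invariant_functions, numPlacements, numPlacements,
    ← Nat.card_prod, ← Nat.card_prod]
  refine Nat.card_congr
    { toFun := fun f => (⟨fun a => (e (f.1 a)).1, fun a => ((he _ _).1.mp (f.2.1 a)).1,
          fun a => ((he _ _).2.mp (f.2.2 a)).1⟩,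
        ⟨fun a => (e (f.1 a)).2.1, fun a => ((he _ _).1.mp (f.2.1 a)).2⟩,
        ⟨fun a => (e (f.1 a)).2.2, fun a => ((he _ _).2.mp (f.2.2 a)).2⟩)
      invFun := fun g => ⟨fun a => e.symm (g.1.1 a, g.2.1.1 a, g.2.2.1 a),
        fun a => (he _ _).1.mpr (by simpa using ⟨g.1.2.1 a, g.2.1.2 a⟩),
        fun a => (he _ _).2.mpr (by simpa using ⟨g.1.2.2 a, g.2.2.2 a⟩)⟩
      left_inv := fun f => by simp
      right_inv := fun g => by simp }

/-- Normalized characters are polynomial along dilations. -/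
theorem exists_polynomial_normChar_dilate {k : ℕ} (μ : YoungDiagram) (π : Equiv.Perm (Fin k)) :
    ∃ p : Polynomial ℚ, ∀ s : ℕ, 0 < s → normChar (dilate μ s) π = p.eval (s : ℚ) := by
  refine ⟨∑ q : Equiv.Perm (Fin k), Polynomial.C
    (((Equiv.Perm.sign q : ℤ) : ℚ) * numPlacements μ (π⁻¹ * q⁻¹) q) *
      (Polynomial.X ^ Nat.card (Quotient (Equiv.Perm.SameCycle.setoid (π⁻¹ * q⁻¹))) *
        Polynomial.X ^ Nat.card (Quotient (Equiv.Perm.SameCycle.setoid q))), fun s hs => ?_⟩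
  rw [normChar_eq_sum_numPlacements, Polynomial.eval_finsetSum]
  refine Finset.sum_congr rfl fun q _ => ?_
  rw [numPlacements_dilate μ hs]
  simp [mul_assoc]

theorem freeCumulant_eq_coeff {k : ℕ} {p : Polynomial ℚ}
    (hp : ∀ s : ℕ, 0 < s → SigmaCycle (dilate μ s) (k - 1) = p.eval (s : ℚ)) :
    freeCumulant μ k = p.coeff k := by
  have h : ∃ p : Polynomial ℚ, ∀ s : ℕ, 0 < s →
      SigmaCycle (dilate μ s) (k - 1) = p.eval (s : ℚ) := ⟨p, hp⟩
  rw [freeCumulant, dif_pos h]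
  congr 1
  refine Polynomial.eq_of_infinite_eval_eq _ _
    (((Set.Ioi_infinite 0).image Nat.cast_injective.injOn).mono (s := Nat.cast '' Set.Ioi (0 : ℕ)) ?_)
  rintro _ ⟨s, hs, rfl⟩
  exact (h.choose_spec s hs).symm.trans (hp s hs)

end

/-- For every integer `k ≥ 2`, every Young diagram `μ` and every positive integer `s`,
the free cumulants are homogeneous of degree `k` under dilation:
`R_k^{sμ} = s^k · R_k^μ`. -/
theorem freeCumulant_dilate (k : ℕ) (hk : 2 ≤ k) (μ : YoungDiagram)
    (s : ℕ) (hs : 0 < s) :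
    freeCumulant (dilate μ s) k = (s : ℚ) ^ k * freeCumulant μ k := by
  obtain ⟨p, hp⟩ := exists_polynomial_normChar_dilate μ (finRotate (k - 1))
  rw [freeCumulant_eq_coeff hp,
    freeCumulant_eq_coeff (p := p.comp (Polynomial.C (s : ℚ) * Polynomial.X)) fun t ht => ?_,
    Polynomial.comp_C_mul_X_coeff, mul_comm]
  rw [dilate_dilate μ hs ht, SigmaCycle, hp _ (Nat.mul_pos hs ht)]
  simp

end AsympRep
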